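/- For every integer r ≥ 1, the binomial moments of the centralized number of elements of a uniformly random Boolean function satisfy lim_{n→∞} B_{2r}(n) · r! · 8^r / 2^{rn} = 1 and lim_{n→∞} B_{2r+1}(n) · (r−1)! · 8^r / 2^{rn} = −1; that is, B_{2r}(n) = 2^{rn}/(r! · 8^r) plus lower order terms in 2^n, and B_{2r+1}(n) = −2^{rn}/((r−1)! · 8^r) plus lower order terms in 2^n. -/

import Mathlib

open Finset Filter

/-- The `s`-th binomial moment of the centralized number of elements of a uniformly random
Boolean function of length `n` (a subset `f ⊆ {0,1}^n`):
`B_s(n) = 2^{−2^n} Σ_{f ⊆ {0,1}^n} (1/s!) ∏_{j=0}^{s−1} (|f| − 2^{n−1} − j)`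
(here the mean `2^{n−1}` is written `2^n/2`). -/
noncomputable def boolBinomMoment (s n : ℕ) : ℝ :=
  (1 / (2 : ℝ) ^ (2 ^ n)) * ∑ f : Finset (Fin n → Bool),
    (1 / (s.factorial : ℝ)) * ∏ j ∈ Finset.range s,
      ((f.card : ℝ) - (2 : ℝ) ^ n / 2 - (j : ℝ))

open PowerSeries in
/-- The generating identity `∑_f (1 + X)^{|f| - N} = 4^N (1 + X²/(4(1 + X)))^N` over the subsets `f`
of a set with `2N` elements. -/
theorem sum_binomialSeries_card_sub {ι : Type*} [Fintype ι] (N : ℕ)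
    (hN : Fintype.card ι = 2 * N) :
    ∑ f : Finset ι, PowerSeries.binomialSeries ℝ ((f.card : ℝ) - N) =
      C ((4 : ℝ) ^ N) *
        (1 + X ^ 2 * (C (1 / 4 : ℝ) * PowerSeries.binomialSeries ℝ (-1 : ℝ))) ^ N := by
  have hunit : PowerSeries.binomialSeries ℝ (-1 : ℝ) * (1 + X) = 1 := by
    have h := PowerSeries.binomialSeries_add (R := ℝ) (A := ℝ) (-1) ((1 : ℕ) : ℝ)
    rw [PowerSeries.binomialSeries_nat] at h
    simpa using h.symm
  have hne : (1 + X : ℝ⟦X⟧) ^ N ≠ 0 :=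
    pow_ne_zero _ (right_ne_zero_of_mul_eq_one hunit)
  apply mul_right_cancel₀ hne
  have hshift (f : Finset ι) :
      PowerSeries.binomialSeries ℝ ((f.card : ℝ) - N) * (1 + X) ^ N = (1 + X) ^ f.card := by
    rw [← PowerSeries.binomialSeries_nat (R := ℝ) N, ← PowerSeries.binomialSeries_add,
      sub_add_cancel, PowerSeries.binomialSeries_nat]
  have hC : (4 : ℝ⟦X⟧) * C (1 / 4 : ℝ) = 1 := by
    rw [← map_ofNat (C (R := ℝ)) 4, ← map_mul]
    norm_num
  have hsq : (4 : ℝ⟦X⟧) *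
      ((1 + X ^ 2 * (C (1 / 4 : ℝ) * PowerSeries.binomialSeries ℝ (-1 : ℝ))) * (1 + X)) =
        (1 + X + 1) ^ 2 := by
    linear_combination X ^ 2 * C (1 / 4 : ℝ) * 4 * hunit + X ^ 2 * hC
  have hsum := Fintype.sum_pow_mul_eq_add_pow ι (1 + X : ℝ⟦X⟧) 1
  simp only [one_pow, mul_one] at hsum
  rw [sum_mul, sum_congr rfl fun f _ => hshift f, hsum, hN, pow_mul, ← hsq, mul_pow, mul_pow,
    map_pow, map_ofNat, mul_assoc]

open PowerSeries in
theorem binomialSeries_neg_one_pow (k : ℕ) :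
    (PowerSeries.binomialSeries ℝ (-1 : ℝ)) ^ k = PowerSeries.binomialSeries ℝ (-(k : ℝ)) := by
  induction k with
  | zero => simp
  | succ k ih => rw [pow_succ, ih, ← PowerSeries.binomialSeries_add]; push_cast; ring_nf

open PowerSeries in
theorem coeff_one_add_X_sq_mul_binomialSeries_pow (N r e : ℕ) (he : e < 2) :
    coeff (2 * r + e) ((1 + X ^ 2 * (C (1 / 4 : ℝ) * PowerSeries.binomialSeries ℝ (-1 : ℝ))) ^ N) =
      ∑ k ∈ range (r + 1),
        (N.choose k : ℝ) * ((1 / 4) ^ k * Ring.choose (-(k : ℝ)) (2 * (r - k) + e)) := by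
  have hterm (k : ℕ) :
      coeff (2 * r + e) ((X ^ 2 * (C (1 / 4 : ℝ) * PowerSeries.binomialSeries ℝ (-1 : ℝ))) ^ k *
        (N.choose k : ℝ⟦X⟧)) = if k ∈ range (r + 1) then
        (N.choose k : ℝ) * ((1 / 4) ^ k * Ring.choose (-(k : ℝ)) (2 * (r - k) + e)) else 0 := by
    rw [mul_pow, mul_pow, ← pow_mul, ← map_pow, binomialSeries_neg_one_pow, mul_assoc,
      coeff_X_pow_mul', ← map_natCast (C (R := ℝ)), coeff_mul_C, coeff_C_mul,
      PowerSeries.binomialSeries_coeff]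
    by_cases hk : k < r + 1
    · rw [if_pos (by omega), if_pos (by simpa using hk),
        show 2 * r + e - 2 * k = 2 * (r - k) + e by omega]
      simp [mul_comm]
    · rw [if_neg (by omega), if_neg (by simpa using hk)]
  rw [add_comm 1, add_pow, map_sum]
  simp only [one_pow, mul_one, hterm]
  rw [← sum_filter, ← sum_filter_of_ne (s := range (r + 1)) (p := fun k => k ∈ range (N + 1))]
  · congr 1
    ext k
    simp [and_comm]
  · intro k _ hk
    rw [mem_range]
    by_contra hlt
    exact hk (by simp [Nat.choose_eq_zero_of_lt (show N < k by omega)])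

theorem inv_factorial_mul_prod_sub_eq_choose (a : ℝ) (s : ℕ) :
    (1 / (s.factorial : ℝ)) * ∏ j ∈ range s, (a - (j : ℝ)) = Ring.choose a s := by
  rw [Ring.choose_eq_smul, ← descPochhammer_eval_eq_prod_range, smul_eq_mul, one_div,
    ← Polynomial.aeval_eq_smeval, Polynomial.aeval_def, ← Polynomial.eval_map, descPochhammer_map]

theorem boolBinomMoment_succ (r e m : ℕ) (he : e < 2) :
    boolBinomMoment (2 * r + e) (m + 1) = ∑ k ∈ range (r + 1),
      ((2 ^ m).choose k : ℝ) * ((1 / 4) ^ k * Ring.choose (-(k : ℝ)) (2 * (r - k) + e)) := by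
  have hcard : Fintype.card (Fin (m + 1) → Bool) = 2 * 2 ^ m := by simp [pow_succ']
  have h := congrArg (PowerSeries.coeff (2 * r + e))
    (sum_binomialSeries_card_sub (ι := Fin (m + 1) → Bool) (2 ^ m) hcard)
  rw [PowerSeries.coeff_C_mul, coeff_one_add_X_sq_mul_binomialSeries_pow _ _ _ he, map_sum] at h
  simp only [PowerSeries.binomialSeries_coeff, smul_eq_mul, mul_one] at h
  have hhalf : (2 : ℝ) ^ (m + 1) / 2 = ((2 ^ m : ℕ) : ℝ) := by push_cast; ring
  simp only [boolBinomMoment, inv_factorial_mul_prod_sub_eq_choose, hhalf]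
  rw [h, pow_succ' 2 m, pow_mul (2 : ℝ), ← mul_assoc]
  norm_num

theorem tendsto_boolBinomMoment_div (r e : ℕ) (he : e < 2) :
    Tendsto (fun n : ℕ => boolBinomMoment (2 * r + e) n / (2 : ℝ) ^ (r * n)) atTop
      (nhds (Ring.choose (-(r : ℝ)) e / (r.factorial * 8 ^ r))) := by
  rw [← tendsto_add_atTop_iff_nat 1]
  have hpow : Tendsto (fun m : ℕ => 2 ^ m) atTop atTop :=
    tendsto_pow_atTop_atTop_of_one_lt one_lt_two
  have hchoose (k : ℕ) :
      Tendsto (fun N : ℕ => (N.choose k : ℝ) / (N : ℝ) ^ k) atTop (nhds (1 / k.factorial)) := by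
    have h1 : Tendsto (fun N : ℕ => (N : ℝ) * (1 / N)) atTop (nhds 1) :=
      tendsto_const_nhds.congr' <| (eventually_ge_atTop 1).mono fun N hN => by
        have : (N : ℝ) ≠ 0 := by positivity
        field_simp
    simpa [div_eq_mul_inv] using ProbabilityTheory.tendsto_choose_mul_pow_atTop k h1
  have hlower (k : ℕ) (hk : k < r) :
      Tendsto (fun N : ℕ => (N.choose k : ℝ) / (N : ℝ) ^ r) atTop (nhds 0) := by
    have hinv : Tendsto (fun N : ℕ => ((N : ℝ) ^ (r - k))⁻¹) atTop (nhds 0) :=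
      ((tendsto_pow_atTop (by omega)).comp tendsto_natCast_atTop_atTop).inv_tendsto_atTop
    have h := (hchoose k).mul hinv
    rw [mul_zero] at h
    refine h.congr fun N => ?_
    rw [div_eq_mul_inv, mul_assoc, ← mul_inv, ← pow_add, Nat.add_sub_cancel' hk.le,
      ← div_eq_mul_inv]
  have hsum : Tendsto (fun N : ℕ => ∑ k ∈ range (r + 1), (N.choose k : ℝ) / (N : ℝ) ^ r *
      ((1 / 4) ^ k * Ring.choose (-(k : ℝ)) (2 * (r - k) + e))) atTop
      (nhds (1 / r.factorial * ((1 / 4) ^ r * Ring.choose (-(r : ℝ)) e))) := by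
    simp only [sum_range_succ]
    rw [← zero_add (1 / (r.factorial : ℝ) * _)]
    refine Tendsto.add ?_ ?_
    · rw [← sum_const_zero (s := range r)]
      refine tendsto_finsetSum _ fun k hk => ?_
      simpa using (hlower k (mem_range.1 hk)).mul_const _
    · simpa using (hchoose r).mul_const ((1 / 4) ^ r * Ring.choose (-(r : ℝ)) e)
  convert (hsum.comp hpow).mul_const (1 / 2 ^ r) using 1
  · ext m
    simp only [Function.comp_apply, boolBinomMoment_succ r e m he, sum_mul, sum_div]
    refine sum_congr rfl fun k _ => ?_
    rw [show r * (m + 1) = m * r + r by ring, pow_add, pow_mul]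
    push_cast
    field_simp
  · rw [show (8 : ℝ) = 4 * 2 by norm_num, mul_pow]
    rw [one_div_pow]
    field_simp

/-- For `r ≥ 1`, `lim_{n→∞} B_{2r}(n) · r! · 8^r / 2^{rn} = 1` and
`lim_{n→∞} B_{2r+1}(n) · (r−1)! · 8^r / 2^{rn} = −1`; that is,
`B_{2r}(n) = 2^{rn}/(r! · 8^r)` plus lower order terms in `2^n` and
`B_{2r+1}(n) = −2^{rn}/((r−1)! · 8^r)` plus lower order terms in `2^n`. -/
theorem boolBinomMoment_leading (r : ℕ) (hr : 1 ≤ r) :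
    Tendsto (fun n : ℕ =>
        boolBinomMoment (2 * r) n * (r.factorial : ℝ) * 8 ^ r / (2 : ℝ) ^ (r * n))
      atTop (nhds 1) ∧
    Tendsto (fun n : ℕ =>
        boolBinomMoment (2 * r + 1) n * ((r - 1).factorial : ℝ) * 8 ^ r / (2 : ℝ) ^ (r * n))
      atTop (nhds (-1)) := by
  constructor
  · have h := (tendsto_boolBinomMoment_div r 0 (by norm_num)).mul_const (r.factorial * 8 ^ r : ℝ)
    rw [Ring.choose_zero_right, div_mul_cancel₀ _ (by positivity)] at h
    refine h.congr fun n => ?_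
    rw [add_zero]
    ring
  · have h := (tendsto_boolBinomMoment_div r 1 (by norm_num)).mul_const
      ((r - 1).factorial * 8 ^ r : ℝ)
    have hr0 : (r : ℝ) ≠ 0 := by positivity
    have hlim : Ring.choose (-(r : ℝ)) 1 / (r.factorial * 8 ^ r) *
        ((r - 1).factorial * 8 ^ r) = -1 := by
      rw [Ring.choose_one_right, ← Nat.mul_factorial_pred (by omega : r ≠ 0)]
      push_cast
      field_simp
    rw [hlim] at h
    refine h.congr fun n => ?_
    ring
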